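/- Let S be a (2,ω)-divisible Cu-semigroup satisfying (O5), (O6) and (O7), and let x',x,t ∈ S be such that x' ≪ x ≤ ∞t. Then there exists a strongly soft element u' ∈ L_x such that x' ≪ u'+t. -/

import Mathlib

open Set

/-- The way-below relation: `x ≪ y` if for every increasing sequence with a
supremum dominating `y`, some term of the sequence dominates `x`. -/
def WayBelow {S : Type*} [Preorder S] (x y : S) : Prop :=
  ∀ z : ℕ → S, Monotone z → ∀ s : S, IsLUB (Set.range z) s → y ≤ s → ∃ m : ℕ, x ≤ z m

/-- A Cu-semigroup: a positively ordered commutative monoid satisfying (O1)-(O4). -/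
class CuSemigroup (S : Type*) extends AddCommMonoid S, PartialOrder S where
  zero_le : ∀ x : S, 0 ≤ x
  add_mono : ∀ {a b c d : S}, a ≤ b → c ≤ d → a + c ≤ b + d
  O1 : ∀ z : ℕ → S, Monotone z → ∃ s : S, IsLUB (Set.range z) s
  O2 : ∀ x : S, ∃ z : ℕ → S, (∀ n, WayBelow (z n) (z (n + 1))) ∧ IsLUB (Set.range z) x
  O3 : ∀ {x' x y' y : S}, WayBelow x' x → WayBelow y' y → WayBelow (x' + y') (x + y)
  O4 : ∀ (x y : ℕ → S), Monotone x → Monotone y → ∀ sx sy : S,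
      IsLUB (Set.range x) sx → IsLUB (Set.range y) sy →
      IsLUB (Set.range fun n => x n + y n) (sx + sy)

variable {S : Type*}

lemma CuSemigroup.nsmul_mono [CuSemigroup S] (x : S) : Monotone fun n : ℕ => n • x := by
  intro n m h
  obtain ⟨k, rfl⟩ := Nat.exists_eq_add_of_le h
  show n • x ≤ (n + k) • x
  rw [add_nsmul]
  calc n • x = n • x + 0 := by rw [add_zero]
    _ ≤ n • x + k • x := CuSemigroup.add_mono le_rfl (CuSemigroup.zero_le _)

/-- `infty x` is the supremum of the increasing sequence `n • x`, i.e. `∞x`. -/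
noncomputable def infty [CuSemigroup S] (x : S) : S :=
  (CuSemigroup.O1 (fun n : ℕ => n • x) (CuSemigroup.nsmul_mono x)).choose

lemma infty_isLUB [CuSemigroup S] (x : S) :
    IsLUB (Set.range fun n : ℕ => n • x) (infty x) :=
  (CuSemigroup.O1 (fun n : ℕ => n • x) (CuSemigroup.nsmul_mono x)).choose_spec

/-- An element is strongly soft if every `x' ≪ x` admits `t` with `x' + t ≪ x`
and `x' ≪ ∞t`. -/
def StronglySoft [CuSemigroup S] (x : S) : Prop :=
  ∀ x' : S, WayBelow x' x → ∃ t : S, WayBelow (x' + t) x ∧ WayBelow x' (infty t)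

def SatisfiesO5 (S : Type*) [CuSemigroup S] : Prop :=
  ∀ x' x y' y z : S, WayBelow x' x → WayBelow y' y → x + y ≤ z →
    ∃ c : S, WayBelow y' c ∧ x' + c ≤ z ∧ z ≤ x + c

def SatisfiesO6 (S : Type*) [CuSemigroup S] : Prop :=
  ∀ x' x y z : S, WayBelow x' x → WayBelow x (y + z) →
    ∃ v w : S, v ≤ x ∧ v ≤ y ∧ w ≤ x ∧ w ≤ z ∧ x' ≤ v + w

def SatisfiesO7 (S : Type*) [CuSemigroup S] : Prop :=
  ∀ x' x y' y w : S, WayBelow x' x → x ≤ w → WayBelow y' y → y ≤ w →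
    ∃ z : S, WayBelow x' z ∧ WayBelow y' z ∧ z ≤ w ∧ z ≤ x + y

def TwoOmegaDivisible (S : Type*) [CuSemigroup S] : Prop :=
  ∀ x' x : S, WayBelow x' x → ∃ y : S, 2 • y ≤ x ∧ x' ≤ infty y

def WeaklyCancellative (S : Type*) [CuSemigroup S] : Prop :=
  ∀ x y z : S, WayBelow (x + z) (y + z) → WayBelow x y

def Separative (S : Type*) [CuSemigroup S] : Prop :=
  ∀ x y t : S, WayBelow (x + t) (y + t) → WayBelow t (infty x) → WayBelow t (infty y) →
    WayBelow x y

def LeftSoftSeparative (S : Type*) [CuSemigroup S] : Prop :=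
  ∀ x y t : S, StronglySoft x → WayBelow (x + t) (y + t) → WayBelow t (infty x) →
    WayBelow t (infty y) → WayBelow x y

def AlmostUnperforated (S : Type*) [CuSemigroup S] : Prop :=
  ∀ x y : S, (∃ n : ℕ, 1 ≤ n ∧ (n + 1) • x ≤ n • y) → x ≤ y

def CountablyBased (S : Type*) [CuSemigroup S] : Prop :=
  ∃ D : Set S, D.Countable ∧
    ∀ x : S, ∃ z : ℕ → S, Monotone z ∧ (∀ n, z n ∈ D) ∧ IsLUB (Set.range z) x

/-- `Lset x` is the set `L_x = { u' : u' ≪ u ≪ x for some strongly soft u }`. -/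
def Lset [CuSemigroup S] (x : S) : Set S :=
  { u' | ∃ u : S, StronglySoft u ∧ WayBelow u' u ∧ WayBelow u x }

/-- A functional on a Cu-semigroup: a monoid morphism to `[0,∞]` preserving order
and suprema of increasing sequences. -/
structure CuFunctional (S : Type*) [CuSemigroup S] where
  toFun : S → ENNReal
  map_zero : toFun 0 = 0
  map_add : ∀ x y : S, toFun (x + y) = toFun x + toFun y
  mono : ∀ x y : S, x ≤ y → toFun x ≤ toFun y
  map_sup : ∀ z : ℕ → S, Monotone z → ∀ s : S, IsLUB (Set.range z) s →
    toFun s = ⨆ n, toFun (z n)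

/-- Predicate version: `f : S → [0,∞]` is a functional on `S`. -/
def IsCuFunctional [CuSemigroup S] (f : S → ENNReal) : Prop :=
  f 0 = 0 ∧ (∀ x y : S, f (x + y) = f x + f y) ∧ (∀ x y : S, x ≤ y → f x ≤ f y) ∧
  (∀ z : ℕ → S, Monotone z → ∀ s : S, IsLUB (Set.range z) s → f s = ⨆ n, f (z n))

/-- Least upper bound of `A` computed within the subset `T`. -/
def IsLUBIn [CuSemigroup S] (T : Set S) (A : Set S) (s : S) : Prop :=
  s ∈ T ∧ s ∈ upperBounds A ∧ ∀ b ∈ T, b ∈ upperBounds A → s ≤ b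

/-- The way-below relation computed within the subset `T`. -/
def WayBelowIn [CuSemigroup S] (T : Set S) (x y : S) : Prop :=
  ∀ z : ℕ → S, Monotone z → (∀ n, z n ∈ T) → ∀ s : S, IsLUBIn T (Set.range z) s → y ≤ s →
    ∃ m : ℕ, x ≤ z m

/-- `T` is a sub-Cu-semigroup of `S`: a submonoid which is itself a Cu-semigroup
for the inherited order, such that the inclusion preserves suprema of increasing
sequences and the way-below relation. -/
structure IsSubCuSemigroup [CuSemigroup S] (T : Set S) : Prop where
  zero_mem : (0 : S) ∈ T
  add_mem : ∀ {x y : S}, x ∈ T → y ∈ T → x + y ∈ T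
  o1 : ∀ z : ℕ → S, Monotone z → (∀ n, z n ∈ T) → ∃ s : S, IsLUBIn T (Set.range z) s
  o2 : ∀ x ∈ T, ∃ z : ℕ → S, (∀ n, z n ∈ T) ∧ (∀ n, WayBelowIn T (z n) (z (n + 1))) ∧
        IsLUBIn T (Set.range z) x
  o3 : ∀ {x' x y' y : S}, x' ∈ T → x ∈ T → y' ∈ T → y ∈ T →
        WayBelowIn T x' x → WayBelowIn T y' y → WayBelowIn T (x' + y') (x + y)
  o4 : ∀ (x y : ℕ → S), Monotone x → Monotone y → (∀ n, x n ∈ T) → (∀ n, y n ∈ T) →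
        ∀ sx sy : S, IsLUBIn T (Set.range x) sx → IsLUBIn T (Set.range y) sy →
        IsLUBIn T (Set.range fun n => x n + y n) (sx + sy)
  incl_sup : ∀ z : ℕ → S, Monotone z → (∀ n, z n ∈ T) → ∀ s : S,
        IsLUBIn T (Set.range z) s → IsLUB (Set.range z) s
  incl_wayBelow : ∀ {x y : S}, x ∈ T → y ∈ T → WayBelowIn T x y → WayBelow x y

def SatisfiesO5In [CuSemigroup S] (T : Set S) : Prop :=
  ∀ x' x y' y z : S, x' ∈ T → x ∈ T → y' ∈ T → y ∈ T → z ∈ T →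
    WayBelowIn T x' x → WayBelowIn T y' y → x + y ≤ z →
    ∃ c ∈ T, WayBelowIn T y' c ∧ x' + c ≤ z ∧ z ≤ x + c

def SatisfiesO6In [CuSemigroup S] (T : Set S) : Prop :=
  ∀ x' x y z : S, x' ∈ T → x ∈ T → y ∈ T → z ∈ T →
    WayBelowIn T x' x → WayBelowIn T x (y + z) →
    ∃ v ∈ T, ∃ w ∈ T, v ≤ x ∧ v ≤ y ∧ w ≤ x ∧ w ≤ z ∧ x' ≤ v + w

def SatisfiesO7In [CuSemigroup S] (T : Set S) : Prop :=
  ∀ x' x y' y w : S, x' ∈ T → x ∈ T → y' ∈ T → y ∈ T → w ∈ T →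
    WayBelowIn T x' x → x ≤ w → WayBelowIn T y' y → y ≤ w →
    ∃ z ∈ T, WayBelowIn T x' z ∧ WayBelowIn T y' z ∧ z ≤ w ∧ z ≤ x + y

/-- `f` is a functional on the sub-Cu-semigroup `T` (values off `T` are irrelevant). -/
def IsFunctionalOn [CuSemigroup S] (T : Set S) (f : S → ENNReal) : Prop :=
  f 0 = 0 ∧
  (∀ x ∈ T, ∀ y ∈ T, f (x + y) = f x + f y) ∧
  (∀ x ∈ T, ∀ y ∈ T, x ≤ y → f x ≤ f y) ∧
  (∀ z : ℕ → S, Monotone z → (∀ n, z n ∈ T) → ∀ s : S, IsLUBIn T (Set.range z) s →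
    f s = ⨆ n, f (z n))

/-- An element is full if `x ≤ ∞e` for every `x`. -/
def IsFull [CuSemigroup S] (e : S) : Prop := ∀ x : S, x ≤ infty e

/-- Condition (R1) for `r`: comparison of `x` with `y` whenever
`λ(x) + r·λ(e) ≤ λ(y)` for all functionals. -/
def SatisfiesR1 (S : Type*) [CuSemigroup S] (e : S) (r : NNReal) : Prop :=
  ∀ x y : S,
    (∀ lam : CuFunctional S, lam.toFun x + (r : ENNReal) * lam.toFun e ≤ lam.toFun y) → x ≤ y

/-- The radius of comparison of `(S, e)`. -/
noncomputable def rc (S : Type*) [CuSemigroup S] (e : S) : ENNReal :=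
  ⨅ r ∈ {r : NNReal | 0 < r ∧ SatisfiesR1 S e r}, (r : ENNReal)

/-- Condition (R1) for the sub-Cu-semigroup `T`. -/
def SatisfiesR1On [CuSemigroup S] (T : Set S) (e : S) (r : NNReal) : Prop :=
  ∀ x ∈ T, ∀ y ∈ T,
    (∀ f : S → ENNReal, IsFunctionalOn T f → f x + (r : ENNReal) * f e ≤ f y) → x ≤ y

/-- The radius of comparison of `(T, e)` for a sub-Cu-semigroup `T ⊆ S`. -/
noncomputable def rcOn [CuSemigroup S] (T : Set S) (e : S) : ENNReal :=
  ⨅ r ∈ {r : NNReal | 0 < r ∧ SatisfiesR1On T e r}, (r : ENNReal)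

/-- `dim S ≤ n` in the sense of covering dimension of Cu-semigroups. -/
def DimLe (S : Type*) [CuSemigroup S] (n : ℕ) : Prop :=
  ∀ (x' x : S) (r : ℕ) (y : Fin r → S), WayBelow x' x → WayBelow x (∑ j, y j) →
    ∃ z : Fin r → Fin (n + 1) → S,
      (∀ j k, WayBelow (z j k) (y j)) ∧
      WayBelow x' (∑ j, ∑ k, z j k) ∧
      (∀ k, WayBelow (∑ j, z j k) x)

/-- The covering dimension of a Cu-semigroup, in `ℕ ∪ {∞}`. -/
noncomputable def cuDim (S : Type*) [CuSemigroup S] : ℕ∞ :=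
  ⨅ n ∈ {n : ℕ | DimLe S n}, (n : ℕ∞)

/-- `dim T ≤ n` for a sub-Cu-semigroup `T ⊆ S`. -/
def DimLeOn [CuSemigroup S] (T : Set S) (n : ℕ) : Prop :=
  ∀ (x' x : S), x' ∈ T → x ∈ T → ∀ (r : ℕ) (y : Fin r → S), (∀ j, y j ∈ T) →
    WayBelowIn T x' x → WayBelowIn T x (∑ j, y j) →
    ∃ z : Fin r → Fin (n + 1) → S,
      (∀ j k, z j k ∈ T) ∧
      (∀ j k, WayBelowIn T (z j k) (y j)) ∧
      WayBelowIn T x' (∑ j, ∑ k, z j k) ∧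
      (∀ k, WayBelowIn T (∑ j, z j k) x)

/-- The covering dimension of a sub-Cu-semigroup `T ⊆ S`. -/
noncomputable def cuDimOn [CuSemigroup S] (T : Set S) : ℕ∞ :=
  ⨅ n ∈ {n : ℕ | DimLeOn T n}, (n : ℕ∞)

namespace WayBelow

theorem le [CuSemigroup S] {x y : S} (h : WayBelow x y) : x ≤ y := by
  obtain ⟨m, hm⟩ := h (fun _ => y) monotone_const y (by simp) le_rfl
  exact hm

theorem trans_le [Preorder S] {x y z : S} (h : WayBelow x y) (hyz : y ≤ z) : WayBelow x z :=
  fun w hw s hs hz => h w hw s hs (hyz.trans hz)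

theorem le_trans [Preorder S] {x y z : S} (hxy : x ≤ y) (h : WayBelow y z) : WayBelow x z :=
  fun w hw s hs hz => (h w hw s hs hz).imp fun _ hm => hxy.trans hm

theorem zero_left [CuSemigroup S] (x : S) : WayBelow 0 x :=
  fun _ _ _ _ _ => ⟨0, CuSemigroup.zero_le _⟩

end WayBelow

namespace CuSemigroup

/-- Every element is the supremum of a monotone sequence of elements way below it. -/
theorem exists_approx [CuSemigroup S] (x : S) :
    ∃ z : ℕ → S, Monotone z ∧ (∀ n, WayBelow (z n) (z (n + 1))) ∧ (∀ n, WayBelow (z n) x) ∧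
      IsLUB (Set.range z) x := by
  obtain ⟨z, hz, hx⟩ := O2 x
  exact ⟨z, monotone_nat_of_le_succ fun n => (hz n).le, hz,
    fun n => (hz n).trans_le (hx.1 ⟨n + 1, rfl⟩), hx⟩

theorem _root_.WayBelow.interpolate [CuSemigroup S] {x y : S} (h : WayBelow x y) :
    ∃ m, WayBelow x m ∧ WayBelow m y := by
  obtain ⟨z, hmono, hz, hzy, hy⟩ := exists_approx y
  obtain ⟨n, hn⟩ := h z hmono y hy le_rfl
  exact ⟨z (n + 1), .le_trans hn (hz n), hzy _⟩

theorem le_add_right' [CuSemigroup S] (x y : S) : x ≤ x + y := by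
  simpa using add_mono (le_refl x) (zero_le y)

theorem nsmul_le_nsmul' [CuSemigroup S] {x y : S} (n : ℕ) (h : x ≤ y) : n • x ≤ n • y := by
  induction n with
  | zero => simp
  | succ n ih => simpa only [succ_nsmul] using add_mono ih h

theorem isLUB_nsmul [CuSemigroup S] {z : ℕ → S} {x : S} (hz : Monotone z)
    (hx : IsLUB (Set.range z) x) (N : ℕ) : IsLUB (Set.range fun n => N • z n) (N • x) := by
  induction N with
  | zero => simp
  | succ N ih =>
    simp only [succ_nsmul]
    exact O4 _ _ (fun a b h => nsmul_le_nsmul' N (hz h)) hz _ _ ih hx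

/-- An element way below a sum is way below a sum of elements way below the summands. -/
theorem _root_.WayBelow.exists_add [CuSemigroup S] {x y z : S} (h : WayBelow x (y + z)) :
    ∃ y' z', WayBelow y' y ∧ WayBelow z' z ∧ WayBelow x (y' + z') := by
  obtain ⟨m, hxm, hm⟩ := h.interpolate
  obtain ⟨a, ha, -, hay, hy⟩ := exists_approx y
  obtain ⟨b, hb, -, hbz, hz⟩ := exists_approx z
  obtain ⟨n, hn⟩ := hm _ (fun i j hij => add_mono (ha hij) (hb hij)) _ (O4 a b ha hb y z hy hz)
    le_rfl
  exact ⟨a n, b n, hay n, hbz n, hxm.trans_le hn⟩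

theorem nsmul_le_infty [CuSemigroup S] (n : ℕ) (x : S) : n • x ≤ infty x :=
  (infty_isLUB x).1 ⟨n, rfl⟩

theorem le_infty [CuSemigroup S] (x : S) : x ≤ infty x := by
  simpa using nsmul_le_infty 1 x

theorem add_le_infty [CuSemigroup S] {x y z : S} (hx : x ≤ infty z) (hy : y ≤ infty z) :
    x + y ≤ infty z := by
  refine (add_mono hx hy).trans
    ((O4 _ _ (nsmul_mono z) (nsmul_mono z) _ _ (infty_isLUB z) (infty_isLUB z)).2 ?_)
  rintro _ ⟨n, rfl⟩
  simpa only [← add_nsmul] using nsmul_le_infty (n + n) z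

theorem infty_le_infty [CuSemigroup S] {x y : S} (h : x ≤ infty y) : infty x ≤ infty y := by
  refine (infty_isLUB x).2 ?_
  rintro _ ⟨n, rfl⟩
  induction n with
  | zero => simpa using zero_le (infty y)
  | succ n ih => simpa only [succ_nsmul] using add_le_infty ih h

theorem le_infty_trans [CuSemigroup S] {x y z : S} (hx : x ≤ infty y) (hy : y ≤ infty z) :
    x ≤ infty z :=
  hx.trans (infty_le_infty hy)

theorem _root_.WayBelow.exists_infty [CuSemigroup S] {x y : S} (h : WayBelow x (infty y)) :
    ∃ y', WayBelow y' y ∧ WayBelow x (infty y') := by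
  obtain ⟨m, hxm, hm⟩ := h.interpolate
  obtain ⟨k, hmk, hk⟩ := hm.interpolate
  obtain ⟨N, hN⟩ := hk _ (nsmul_mono y) _ (infty_isLUB y) le_rfl
  obtain ⟨z, hz, -, hzy, hy⟩ := exists_approx y
  obtain ⟨n, hn⟩ := hmk _ (fun a b h => nsmul_le_nsmul' N (hz h)) _ (isLUB_nsmul hz hy N) hN
  exact ⟨z n, hzy n, hxm.trans_le (hn.trans (nsmul_le_infty N _))⟩

end CuSemigroup

open CuSemigroup

theorem StronglySoft.add_left [CuSemigroup S] {s v : S} (hs : StronglySoft s)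
    (hv : v ≤ infty s) : StronglySoft (v + s) := by
  intro y hy
  obtain ⟨v₀, s₀, hv₀, hs₀, hy₀⟩ := hy.exists_add
  obtain ⟨s₁, hs₁, hvs₁⟩ := (hv₀.trans_le hv).exists_infty
  obtain ⟨z, hz, -, hzs, hsup⟩ := exists_approx s
  obtain ⟨i, hi⟩ := hs₀ z hz s hsup le_rfl
  obtain ⟨j, hj⟩ := hs₁ z hz s hsup le_rfl
  have hi' : s₀ ≤ z (max i j) := hi.trans (hz (le_max_left i j))
  have hj' : s₁ ≤ z (max i j) := hj.trans (hz (le_max_right i j))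
  obtain ⟨t, ht, hzt⟩ := hs _ (hzs (max i j))
  refine ⟨t, ?_, hy₀.trans_le (add_le_infty ?_ (hi'.trans hzt.le))⟩
  · refine .le_trans ?_ (O3 hv₀ ht)
    rw [← add_assoc]
    exact add_mono (hy₀.le.trans (add_mono le_rfl hi')) le_rfl
  · exact le_infty_trans hvs₁.le (hj'.trans hzt.le)

theorem TwoOmegaDivisible.exists_halving [CuSemigroup S] (hdiv : TwoOmegaDivisible S) {c b : S}
    (h : WayBelow c b) :
    ∃ a' c' b' : S, 2 • b' ≤ b ∧ WayBelow a' c' ∧ WayBelow c' b' ∧ c ≤ infty a' := by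
  obtain ⟨m, hcm, hmb⟩ := h.interpolate
  obtain ⟨y, hyb, hmy⟩ := hdiv m b hmb
  obtain ⟨a, hay, hca⟩ := (hcm.trans_le hmy).exists_infty
  obtain ⟨c', hac, hcy⟩ := hay.interpolate
  exact ⟨a, c', y, hyb, hac, hcy, hca.le⟩

/-- In a `(2,ω)`-divisible Cu-semigroup, every element dominates strongly soft elements
generating ideals that contain any prescribed element way below it. -/
theorem TwoOmegaDivisible.exists_stronglySoft [CuSemigroup S] (hdiv : TwoOmegaDivisible S)
    {x' x : S} (h : WayBelow x' x) :
    ∃ s : S, StronglySoft s ∧ s ≤ x ∧ x' ≤ infty s := by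
  choose! a c b hb hac hcb hca using fun (p : S × S) (hp : WayBelow p.1 p.2) =>
    hdiv.exists_halving hp
  let q : ℕ → S × S := fun n => (fun p => (c p, b p))^[n] (x', x)
  have hq_succ (n : ℕ) : q (n + 1) = (c (q n), b (q n)) := Function.iterate_succ_apply' _ _ _
  have hq (n : ℕ) : WayBelow (q n).1 (q n).2 := by
    induction n with
    | zero => exact h
    | succ n ih => rw [hq_succ]; exact hcb _ ih
  let σ : ℕ → S := fun n => ∑ k ∈ Finset.range n, c (q k)
  have hσ_succ (n : ℕ) : σ (n + 1) = σ n + c (q n) := Finset.sum_range_succ _ _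
  have hσ_mono : Monotone σ := monotone_nat_of_le_succ fun n => by
    rw [hσ_succ]; exact le_add_right' _ _
  have hσ_le (n : ℕ) : σ n + (q n).2 ≤ x := by
    induction n with
    | zero => simp [σ, q]
    | succ n ih =>
      refine le_trans ?_ ih
      rw [hσ_succ, hq_succ, add_assoc]
      refine add_mono le_rfl (le_trans ?_ (hb _ (hq n)))
      rw [two_nsmul]
      exact add_mono (hcb _ (hq n)).le le_rfl
  have hc (n : ℕ) : c (q n) = (q (n + 1)).1 := by rw [hq_succ]
  have hσ_infty (n : ℕ) : σ n ≤ infty (a (q n)) := by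
    induction n with
    | zero => simpa [σ] using zero_le _
    | succ n ih =>
      have hcn : c (q n) ≤ infty (a (q (n + 1))) := by
        rw [hc]; exact hca _ (hq _)
      rw [hσ_succ]
      exact add_le_infty (le_infty_trans ih ((hac _ (hq n)).le.trans hcn)) hcn
  obtain ⟨s, hs⟩ := O1 σ hσ_mono
  have hσs (n : ℕ) : σ n ≤ s := hs.1 ⟨n, rfl⟩
  refine ⟨s, ?_, hs.2 ?_, ?_⟩
  · intro z hz
    obtain ⟨z₁, hzz₁, hz₁⟩ := hz.interpolate
    obtain ⟨n, hn⟩ := hz₁ σ hσ_mono s hs le_rfl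
    refine ⟨a (q n), ?_, hzz₁.trans_le (hn.trans (hσ_infty n))⟩
    refine (O3 hzz₁ (hac _ (hq n))).trans_le (le_trans ?_ (hσs (n + 1)))
    rw [hσ_succ]
    exact add_mono hn le_rfl
  · rintro _ ⟨n, rfl⟩
    exact (le_add_right' _ _).trans (hσ_le n)
  · refine le_infty_trans (hca (q 0) (hq 0)) (((hac _ (hq 0)).le.trans ?_).trans (le_infty s))
    simpa [σ] using hσs 1

theorem TwoOmegaDivisible.exists_two_pow [CuSemigroup S] (hdiv : TwoOmegaDivisible S) (k : ℕ)
    {x' x : S} (h : WayBelow x' x) : ∃ y : S, 2 ^ k • y ≤ x ∧ x' ≤ infty y := by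
  induction k generalizing x' x with
  | zero => exact ⟨x, by simp, h.le.trans (le_infty x)⟩
  | succ k ih =>
    obtain ⟨m, hxm, hmx⟩ := h.interpolate
    obtain ⟨y, hyx, hmy⟩ := ih hmx
    obtain ⟨y', hy'y, hxy'⟩ := (hxm.trans_le hmy).exists_infty
    obtain ⟨z, hzy, hy'z⟩ := hdiv y' y hy'y
    refine ⟨z, ?_, le_infty_trans hxy'.le hy'z⟩
    rw [pow_succ, mul_nsmul']
    exact (nsmul_le_nsmul' _ hzy).trans hyx

theorem exists_le_nsmul_of_wayBelow_nsmul [CuSemigroup S] (hO6 : SatisfiesO6 S)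
    (hO7 : SatisfiesO7 S) {t : S} (N : ℕ) {y' y : S} (h : WayBelow y' y)
    (hy : WayBelow y (N • t)) : ∃ z : S, z ≤ t ∧ z ≤ N • y ∧ y' ≤ infty z := by
  induction N generalizing y' y with
  | zero =>
    refine ⟨0, zero_le t, zero_le _, ?_⟩
    exact (h.le.trans (by simpa using hy.le)).trans (zero_le _)
  | succ N ih =>
    obtain ⟨m, hym, hmy⟩ := h.interpolate
    rw [succ_nsmul] at hy
    obtain ⟨v, w, hvy, hvt, hwy, hwt, hm⟩ := hO6 m y _ _ hmy hy
    obtain ⟨v₀, w₀, hv₀, hw₀, hy'⟩ := (hym.trans_le hm).exists_add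
    obtain ⟨v₂, hv₀₂, hv₂⟩ := hv₀.interpolate
    obtain ⟨v₁, hv₀₁, hv₁₂⟩ := hv₀₂.interpolate
    obtain ⟨z, hzt, hzv, hvz⟩ := ih hv₁₂ (hv₂.trans_le hvt)
    obtain ⟨z', hz'z, hvz'⟩ := (hv₀₁.trans_le hvz).exists_infty
    obtain ⟨e, hze, hwe, het, hezw⟩ := hO7 z' z w₀ w t hz'z hzt hw₀ hwt
    refine ⟨e, het, ?_, hy'.le.trans (add_le_infty ?_ (hwe.le.trans (le_infty e)))⟩
    · rw [succ_nsmul]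
      exact hezw.trans (add_mono (hzv.trans (nsmul_le_nsmul' N (hv₂.le.trans hvy))) hwy)
    · exact le_infty_trans hvz'.le (hze.le.trans (le_infty e))

theorem exists_le_le_of_wayBelow_nsmul [CuSemigroup S] (hdiv : TwoOmegaDivisible S)
    (hO6 : SatisfiesO6 S) (hO7 : SatisfiesO7 S) {t : S} (N : ℕ) {p q : S} (h : WayBelow p q)
    (hq : WayBelow q (N • t)) : ∃ z : S, z ≤ t ∧ z ≤ q ∧ p ≤ infty z := by
  obtain ⟨m, hpm, hmq⟩ := h.interpolate
  obtain ⟨y, hyq, hmy⟩ := hdiv.exists_two_pow N hmq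
  obtain ⟨y', hy'y, hpy'⟩ := (hpm.trans_le hmy).exists_infty
  have hyq' : y ≤ q := by
    refine le_trans ?_ hyq
    simpa using nsmul_mono y (Nat.one_le_two_pow (n := N))
  obtain ⟨z, hzt, hzy, hy'z⟩ :=
    exists_le_nsmul_of_wayBelow_nsmul hO6 hO7 N hy'y (.le_trans hyq' hq)
  exact ⟨z, hzt, (hzy.trans (nsmul_mono y Nat.lt_two_pow_self.le)).trans hyq,
    le_infty_trans hpy'.le hy'z⟩

/-- Strongly soft elements are approximated from below by strongly soft elements. -/
theorem StronglySoft.exists_between [CuSemigroup S] (hdiv : TwoOmegaDivisible S) {y u : S}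
    (hu : StronglySoft u) (h : WayBelow y u) :
    ∃ u' : S, StronglySoft u' ∧ y ≤ u' ∧ WayBelow u' u := by
  obtain ⟨r, hr, hyr⟩ := hu y h
  obtain ⟨r', hr'r, hyr'⟩ := hyr.exists_infty
  obtain ⟨s, hs, hsr, hr's⟩ := hdiv.exists_stronglySoft hr'r
  exact ⟨y + s, hs.add_left (le_infty_trans hyr'.le hr's), le_add_right' _ _,
    .le_trans (add_mono le_rfl hsr) hr⟩

/-- In a (2,ω)-divisible Cu-semigroup satisfying (O5)-(O7), if
`x' ≪ x ≤ ∞t` then there is a strongly soft `u' ∈ L_x` with `x' ≪ u' + t`. -/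
theorem sigma_domination {S : Type*} [CuSemigroup S]
    (hdiv : TwoOmegaDivisible S)
    (hO5 : SatisfiesO5 S) (hO6 : SatisfiesO6 S) (hO7 : SatisfiesO7 S)
    {x' x t : S} (h1 : WayBelow x' x) (h2 : x ≤ infty t) :
    ∃ u' : S, u' ∈ Lset x ∧ StronglySoft u' ∧ WayBelow x' (u' + t) := by
  obtain ⟨x₀, h₀, hx₀⟩ := h1.interpolate
  obtain ⟨x₁, h₁, hx₁⟩ := hx₀.interpolate
  obtain ⟨x₂, h₂, hx₂⟩ := hx₁.interpolate
  obtain ⟨x₃, h₃, hx₃⟩ := hx₂.interpolate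
  obtain ⟨x₄, h₄, hx₄⟩ := hx₃.interpolate
  obtain ⟨N, hN⟩ := hx₄ _ (nsmul_mono t) _ (infty_isLUB t) h2
  obtain ⟨c, hct, hcx, hxc⟩ :=
    exists_le_le_of_wayBelow_nsmul hdiv hO6 hO7 N h₃ (h₄.trans_le hN)
  obtain ⟨c₁, hc₁, hxc₁⟩ := (h₂.trans_le hxc).exists_infty
  obtain ⟨c₂, hc₂, hxc₂⟩ := hxc₁.exists_infty
  obtain ⟨u, -, hcu, hux⟩ := hO5 c₁ c 0 0 x₃ hc₁ (.zero_left 0) (by simpa using hcx)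
  obtain ⟨w, v, -, hwc, hvx, hvu, hwv⟩ :=
    hO6 x₀ x₁ c u h₁ ((h₂.trans_le h₃.le).trans_le hux)
  obtain ⟨s, hs, hsc, hcs⟩ := hdiv.exists_stronglySoft hc₂
  have hsoft : StronglySoft (v + s) := hs.add_left (hvx.trans (le_infty_trans hxc₂.le hcs))
  have hlt : WayBelow (v + s) x := by
    refine .le_trans ?_ hx₃
    rw [add_comm]
    exact (add_mono hsc hvu).trans hcu
  have hdom : x₀ ≤ (v + s) + t := by
    rw [add_comm] at hwv
    exact hwv.trans (add_mono (le_add_right' _ _) (hwc.trans hct))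
  obtain ⟨y, t', hy, ht', hx'⟩ := (h₀.trans_le hdom).exists_add
  obtain ⟨u', hu', hyu', hu'v⟩ := hsoft.exists_between hdiv hy
  exact ⟨u', ⟨v + s, hsoft, hu'v, hlt⟩, hu', hx'.trans_le (add_mono hyu' ht'.le)⟩
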